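/- Fix an integer n ≥ 4. Let γ be the spectral gap of the adjacent-swap chain P on COM_n (reversible with respect to the Tajima distribution) and γ^L the spectral gap of the adjacent-swap chain P^L on COM^L_n (reversible with respect to the uniform distribution). Then the relaxation times τ = 1/γ and τ^L = 1/γ^L satisfy τ^L ≥ τ ≥ (2/90)·n(n+1)(n−3); equivalently, γ^L ≤ γ ≤ 45/(n(n+1)(n−3)). -/

import Mathlib

open Finset

/-- Labels for a labeled constrained ordered matching of order `n`:
`Sum.inl i` is the leaf label `ℓ_{i+1}`, and `Sum.inr j` is the internal label `j+1`. -/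
abbrev LLabel (n : ℕ) := Fin n ⊕ Fin (n - 2)

/-- `p` is a labeled constrained ordered matching: the pairs `p 0, …, p (n-2)`
(0-indexed versions of `p_1, …, p_{n-1}`) have size two, partition the label set,
and the internal label `j+1` (i.e. `Sum.inr j`) may only appear in pair `p_k`
(1-indexed pair `k+1`) when `j + 1 < k + 1`. -/
def IsLCOM (n : ℕ) (p : Fin (n - 1) → Finset (LLabel n)) : Prop :=
  (∀ k, (p k).card = 2) ∧
  (∀ a : LLabel n, ∃ k, a ∈ p k ∧ ∀ k', a ∈ p k' → k' = k) ∧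
  (∀ (j : Fin (n - 2)) (k : Fin (n - 1)), Sum.inr j ∈ p k → (j : ℕ) < (k : ℕ))

instance (n : ℕ) : DecidablePred (IsLCOM n) := fun _ => by
  unfold IsLCOM; infer_instance

/-- The set of labeled constrained ordered matchings `COM^L_n`. -/
abbrev LCOM (n : ℕ) : Type := {p : Fin (n - 1) → Finset (LLabel n) // IsLCOM n p}

/-- Index of the pair `p_k` (1-indexed `k ∈ {1,…,n-2}`) as an element of `Fin (n-1)`. -/
def idx1 {n : ℕ} (k : Fin (n - 2)) : Fin (n - 1) := ⟨k, by have := k.isLt; omega⟩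

/-- Index of the pair `p_{k+1}` as an element of `Fin (n-1)`. -/
def idx2 {n : ℕ} (k : Fin (n - 2)) : Fin (n - 1) := ⟨(k : ℕ) + 1, by have := k.isLt; omega⟩

/-- Result of exchanging label `l1` from pair `k` with label `l2` from pair `k+1`. -/
def lswapFun (n : ℕ) (p : Fin (n - 1) → Finset (LLabel n)) (k : Fin (n - 2))
    (l1 l2 : LLabel n) : Fin (n - 1) → Finset (LLabel n) :=
  fun i =>
    if i = idx1 k then insert l2 ((p (idx1 k)).erase l1)
    else if i = idx2 k then insert l1 ((p (idx2 k)).erase l2)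
    else p i

/-- The state obtained from `x` when attempting to exchange `l1 ∈ p_k` with `l2 ∈ p_{k+1}`:
the swap is performed if it yields a valid constrained ordered matching,
otherwise the chain stays at `x`. -/
def lswapDest (n : ℕ) (x : LCOM n) (k : Fin (n - 2)) (l1 l2 : LLabel n) :
    Fin (n - 1) → Finset (LLabel n) :=
  if IsLCOM n (lswapFun n x.val k l1 l2) then lswapFun n x.val k l1 l2 else x.val

/-- Transition matrix of the adjacent-swap Markov chain on `COM^L_n`:
pick `k ∈ {1,…,n-2}` uniformly, pick `l1` uniformly from the two elements of `p_k`
and `l2` uniformly from the two elements of `p_{k+1}`, and swap them if allowed. -/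
noncomputable def PL (n : ℕ) (x y : LCOM n) : ℝ :=
  (1 / ((n : ℝ) - 2)) * ∑ k : Fin (n - 2), ∑ l1 ∈ x.val (idx1 k), ∑ l2 ∈ x.val (idx2 k),
    (1 / 4 : ℝ) * (if lswapDest n x k l1 l2 = y.val then 1 else 0)

/-- The adjacent-swap transition matrix on `COM^L_n` as a matrix. -/
noncomputable def PLmat (n : ℕ) : Matrix (LCOM n) (LCOM n) ℝ := Matrix.of (PL n)

/-- `p` is an unlabeled constrained ordered matching: each `p k` is a multiset of size two
over the symbols `Fin (n-1)` (symbol `0` stands for a leaf, symbol `j ≠ 0` for the internal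
label `j`); across all pairs the symbol `0` appears `n` times and each internal label once;
and the internal label `j` may only appear in pair `p k` (1-indexed pair `k+1`) when 
`j < k + 1`, i.e. `j ≤ k`. -/
def IsUCOMraw (n : ℕ) (p : Fin (n - 1) → Multiset (Fin (n - 1))) : Prop :=
  (∀ k, Multiset.card (p k) = 2) ∧
  (∀ s : Fin (n - 1), (∑ k, (p k).count s) = if (s : ℕ) = 0 then n else 1) ∧
  (∀ (j k : Fin (n - 1)), (j : ℕ) ≠ 0 → j ∈ p k → (j : ℕ) ≤ (k : ℕ))

instance (n : ℕ) : DecidablePred (IsUCOMraw n) := fun _ => by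
  unfold IsUCOMraw; infer_instance

instance (n : ℕ) :
    DecidablePred (fun p : Fin (n - 1) → Sym (Fin (n - 1)) 2 =>
      IsUCOMraw n (fun k => (p k : Multiset (Fin (n - 1))))) := fun _ => by
  infer_instance

/-- The set of unlabeled constrained ordered matchings `COM_n`; each pair is stored as an
unordered pair with possible repetition (`Sym _ 2`), with the validity predicate imposed on
the underlying multisets. -/
abbrev UCOM (n : ℕ) : Type :=
  {p : Fin (n - 1) → Sym (Fin (n - 1)) 2 //
    IsUCOMraw n (fun k => (p k : Multiset (Fin (n - 1))))}

/-- The sequence of size-two multisets underlying an unlabeled constrained ordered matching. -/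
def uraw (n : ℕ) (x : UCOM n) : Fin (n - 1) → Multiset (Fin (n - 1)) :=
  fun k => (x.val k : Multiset (Fin (n - 1)))

/-- Result of exchanging symbol `l1` from pair `k` with symbol `l2` from pair `k+1`. -/
def uswapFun (n : ℕ) (p : Fin (n - 1) → Multiset (Fin (n - 1))) (k : Fin (n - 2))
    (l1 l2 : Fin (n - 1)) : Fin (n - 1) → Multiset (Fin (n - 1)) :=
  fun i =>
    if i = idx1 k then l2 ::ₘ (p (idx1 k)).erase l1
    else if i = idx2 k then l1 ::ₘ (p (idx2 k)).erase l2
    else p i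

/-- The state obtained from `x` when attempting to exchange `l1 ∈ p_k` with `l2 ∈ p_{k+1}`:
the swap is performed if it yields a valid constrained ordered matching,
otherwise the chain stays at `x`. -/
def uswapDest (n : ℕ) (x : UCOM n) (k : Fin (n - 2)) (l1 l2 : Fin (n - 1)) :
    Fin (n - 1) → Multiset (Fin (n - 1)) :=
  if IsUCOMraw n (uswapFun n (uraw n x) k l1 l2) then uswapFun n (uraw n x) k l1 l2
  else uraw n x

/-- Transition matrix of the adjacent-swap Markov chain on `COM_n`:
pick `k ∈ {1,…,n-2}` uniformly, pick `l1` uniformly from the multiset `p_k`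
and `l2` uniformly from the multiset `p_{k+1}` (each of the two slots of a pair
with probability 1/2), and swap them if allowed. -/
noncomputable def PU (n : ℕ) (x y : UCOM n) : ℝ :=
  (1 / ((n : ℝ) - 2)) * ∑ k : Fin (n - 2),
    ((uraw n x (idx1 k)).map (fun l1 =>
      ((uraw n x (idx2 k)).map (fun l2 =>
        (1 / 4 : ℝ) * (if uswapDest n x k l1 l2 = uraw n y then 1 else 0))).sum)).sum

/-- The adjacent-swap transition matrix on `COM_n` as a matrix. -/
noncomputable def PUmat (n : ℕ) : Matrix (UCOM n) (UCOM n) ℝ := Matrix.of (PU n)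

/-- The number of cherries of `T`: pairs all of whose elements are the leaf symbol `0`,
i.e. pairs equal to `{0,0}`. -/
def cherries (n : ℕ) (T : UCOM n) : ℕ :=
  (Finset.univ.filter (fun k : Fin (n - 1) => ∀ a ∈ uraw n T k, (a : ℕ) = 0)).card

/-- The Tajima coalescent distribution on `COM_n`. -/
noncomputable def tajima (n : ℕ) (T : UCOM n) : ℝ :=
  (2 : ℝ) ^ (n - cherries n T - 1) / (Nat.factorial (n - 1))

/-- The (1-indexed, shifted down by one) index of the pair containing the internal label `j`:
`Ix n x j` is the unique `k` (0-indexed) with `j ∈ p_{k+1}`, so that `I_x(j) = Ix n x j + 1`. -/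
noncomputable def Ix (n : ℕ) (x : UCOM n) (j : Fin (n - 1)) : ℕ :=
  sInf {k : ℕ | ∃ h : k < n - 1, j ∈ uraw n x ⟨k, h⟩}

/-- The internal tree length `φ(x) = ∑_{j=1}^{n-2} (I_x(j) - j)`. -/
noncomputable def itl (n : ℕ) (x : UCOM n) : ℤ :=
  ∑ j ∈ Finset.univ.filter (fun j : Fin (n - 1) => (j : ℕ) ≠ 0),
    ((Ix n x j : ℤ) + 1 - (j : ℤ))

/-- The largest absolute value of an eigenvalue of `M` different from the eigenvalue `1`. -/
noncomputable def lamStar {S : Type*} [Fintype S] [DecidableEq S] (M : Matrix S S ℝ) : ℝ :=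
  sSup {r : ℝ | ∃ μ : ℝ, μ ≠ 1 ∧ Module.End.HasEigenvalue (Matrix.toLin' M) μ ∧ r = |μ|}

/-- The spectral gap `γ = 1 - λ*` of a transition matrix `M`. -/
noncomputable def specGap {S : Type*} [Fintype S] [DecidableEq S] (M : Matrix S S ℝ) : ℝ :=
  1 - lamStar M

/-- Mixing time of a chain with transition matrix `M` and stationary distribution `π`:
`max_{x₀} min { t ≥ 0 : ‖M^t(x₀,·) − π‖_TV < 1/4 }`. -/
noncomputable def mixingTime {S : Type*} [Fintype S] [DecidableEq S]
    (M : Matrix S S ℝ) (π : S → ℝ) : ℕ :=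
  Finset.univ.sup fun x0 : S =>
    sInf {t : ℕ | (1 / 2 : ℝ) * ∑ y : S, |(M ^ t) x0 y - π y| < 1 / 4}


lemma gen_hasEig {S : Type*} [Fintype S] [DecidableEq S] {M : Matrix S S ℝ} {μ : ℝ} :
    Module.End.HasEigenvalue (Matrix.toLin' M) μ ↔ ∃ g : S → ℝ, g ≠ 0 ∧ M.mulVec g = μ • g := by
  constructor
  · intro h
    obtain ⟨v, hv⟩ := h.exists_hasEigenvector
    exact ⟨v, hv.2, by simpa using hv.apply_eq_smul⟩
  · rintro ⟨g, hg, h⟩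
    exact Module.End.hasEigenvalue_of_hasEigenvector (x := g)
      ⟨Module.End.mem_eigenspace_iff.2 (by simpa using h), hg⟩

lemma gen_spec {S : Type*} [Fintype S] [DecidableEq S] (M : Matrix S S ℝ) (w : S → ℝ)
    (hw : ∀ u, 0 < w u) (hrev : ∀ u v, w u * M u v = w v * M v u) (f : S → ℝ) (lam : ℝ)
    (hlam : ∀ μ : ℝ, μ ≠ 1 → Module.End.HasEigenvalue (Matrix.toLin' M) μ → μ ≤ lam)
    (hharm : ∀ g : S → ℝ, M.mulVec g = g → ∑ u, w u * g u * f u = 0) :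
    ∑ u, w u * f u * (M.mulVec f) u ≤ lam * ∑ u, w u * f u ^ 2 := by
  classical
  set s : S → ℝ := fun u => Real.sqrt (w u) with hs
  have hspos : ∀ u, 0 < s u := fun u => Real.sqrt_pos.2 (hw u)
  have hss : ∀ u, s u * s u = w u := fun u => Real.mul_self_sqrt (hw u).le
  set A : Matrix S S ℝ := Matrix.of fun u v => s u * M u v / s v with hA
  have hH : A.IsHermitian := by
    ext u v
    simp only [Matrix.conjTranspose_apply, hA, Matrix.of_apply, star_trivial]
    have h1 := (hspos u).ne'
    have h2 := (hspos v).ne'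
    rw [div_eq_div_iff h1 h2]
    have := hrev u v
    rw [← hss, ← hss] at this
    linarith
  set b := hH.eigenvectorBasis
  let F : EuclideanSpace ℝ S := WithLp.toLp 2 (fun u => s u * f u)
  -- eigen data
  have heig : ∀ i, M.mulVec (fun u => b i u / s u) = hH.eigenvalues i • (fun u => b i u / s u) := by
    intro i
    have h := hH.mulVec_eigenvectorBasis i
    ext u
    have hu := congrFun h u
    simp only [Matrix.mulVec, dotProduct, hA, Matrix.of_apply, Pi.smul_apply, smul_eq_mul] at hu ⊢
    have h1 := (hspos u).ne'
    rw [← mul_div_assoc, eq_div_iff h1]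
    rw [← hu, Finset.sum_mul]
    refine Finset.sum_congr rfl fun v _ => ?_
    have h2 := (hspos v).ne'
    simp only [b]
    field_simp
  have hne : ∀ i, (fun u => b i u / s u) ≠ 0 := by
    intro i h
    have : b i = 0 := by
      ext u
      have hu := congrFun h u
      simp only [Pi.zero_apply, div_eq_zero_iff, (hspos u).ne', or_false] at hu
      simpa using hu
    exact b.toBasis.ne_zero i (by simpa using this)
  have hinner : ∀ i, inner ℝ (b i) F = ∑ u, b i u * (s u * f u) := by
    intro i
    simp [PiLp.inner_apply, F, mul_comm]
  have hAF : ∀ i, inner ℝ (b i) (WithLp.toLp 2 (A.mulVec F) : EuclideanSpace ℝ S) = hH.eigenvalues i * inner ℝ (b i) F := by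
    intro i
    have h := hH.mulVec_eigenvectorBasis i
    have e1 : inner ℝ (b i) (WithLp.toLp 2 (A.mulVec F) : EuclideanSpace ℝ S) = ((b i : EuclideanSpace ℝ S) : S → ℝ) ⬝ᵥ A.mulVec F := by
      simp [PiLp.inner_apply, dotProduct, mul_comm]
    have e2 : inner ℝ (b i) F = ((b i : EuclideanSpace ℝ S) : S → ℝ) ⬝ᵥ F := by
      simp [PiLp.inner_apply, dotProduct, mul_comm]
    rw [e1, e2, Matrix.dotProduct_mulVec, ← Matrix.mulVec_transpose]
    have : A.transpose = A := by
      have := hH.eq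
      rwa [Matrix.conjTranspose_eq_transpose_of_trivial] at this
    rw [this, h, smul_dotProduct, smul_eq_mul]
  have key1 : ∑ u, w u * f u * (M.mulVec f) u
      = inner ℝ F (WithLp.toLp 2 (A.mulVec F) : EuclideanSpace ℝ S) := by
    simp only [PiLp.inner_apply, F, Matrix.mulVec, dotProduct, hA, Matrix.of_apply]
    refine Finset.sum_congr rfl fun u _ => ?_
    simp only [RCLike.inner_apply, conj_trivial]
    rw [Finset.mul_sum, Finset.sum_mul]
    refine Finset.sum_congr rfl fun v _ => ?_
    have h2 := (hspos v).ne'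
    rw [← hss]
    field_simp
  have key2 : ∑ u, w u * f u ^ 2 = inner ℝ F F := by
    simp only [PiLp.inner_apply, F]
    refine Finset.sum_congr rfl fun u _ => ?_
    simp only [RCLike.inner_apply, conj_trivial]
    rw [← hss]; ring
  rw [key1, key2, ← b.sum_inner_mul_inner, ← b.sum_inner_mul_inner, Finset.mul_sum]
  refine Finset.sum_le_sum fun i _ => ?_
  rw [hAF, real_inner_comm]
  by_cases h1 : hH.eigenvalues i = 1
  · have hz : inner ℝ (b i) F = 0 := by
      have := hharm _ (by rw [heig i, h1, one_smul])
      rw [hinner, ← this]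
      refine Finset.sum_congr rfl fun u _ => ?_
      have h2 := (hspos u).ne'
      rw [← hss]
      field_simp
    rw [hz]; simp
  · have := hlam _ h1 (gen_hasEig.2 ⟨_, hne i, heig i⟩)
    nlinarith [mul_self_nonneg (inner ℝ (b i) F)]

lemma gen_abs_lt {S : Type*} [Fintype S] [DecidableEq S] (M : Matrix S S ℝ)
    (h0 : ∀ x y, 0 ≤ M x y) (h1 : ∀ x, ∑ y, M x y = 1) (hd : ∀ x, 0 < M x x) (μ : ℝ)
    (hμ : Module.End.HasEigenvalue (Matrix.toLin' M) μ) (hμ1 : μ ≠ 1) : |μ| < 1 := by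
  obtain ⟨g, hg, h⟩ := gen_hasEig.1 hμ
  have hS : (Finset.univ : Finset S).Nonempty := by
    by_contra hc
    apply hg
    ext x
    exact absurd ⟨x, Finset.mem_univ x⟩ hc
  obtain ⟨x, -, hx⟩ := Finset.exists_max_image Finset.univ (fun x => |g x|) hS
  have hxpos : 0 < |g x| := by
    obtain ⟨y, hy⟩ := Function.ne_iff.1 hg
    exact lt_of_lt_of_le (abs_pos.2 hy) (hx y (Finset.mem_univ _))
  have hxe := congrFun h x
  simp only [Matrix.mulVec, dotProduct, Pi.smul_apply, smul_eq_mul] at hxe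
  rw [← Finset.add_sum_erase _ _ (Finset.mem_univ x)] at hxe
  have hs := h1 x
  rw [← Finset.add_sum_erase _ _ (Finset.mem_univ x)] at hs
  set r := ∑ y ∈ Finset.univ.erase x, M x y * g y with hr
  set t := ∑ y ∈ Finset.univ.erase x, M x y with ht
  have hrt : |r| ≤ t * |g x| := by
    rw [hr, ht, Finset.sum_mul]
    refine (Finset.abs_sum_le_sum_abs _ _).trans (Finset.sum_le_sum fun y _ => ?_)
    rw [abs_mul, abs_of_nonneg (h0 x y)]
    exact mul_le_mul_of_nonneg_left (hx y (Finset.mem_univ _)) (h0 x y)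
  have e : |μ - M x x| * |g x| ≤ t * |g x| := by
    rw [← abs_mul]
    have : (μ - M x x) * g x = r := by linarith
    rwa [this]
  have e2 := le_of_mul_le_mul_right e hxpos
  rw [abs_le] at e2
  rw [abs_lt]
  have := hd x
  refine ⟨by linarith, lt_of_le_of_ne (by linarith) hμ1⟩

lemma gen_lamStar_set_finite {S : Type*} [Fintype S] [DecidableEq S] (M : Matrix S S ℝ) :
    {r : ℝ | ∃ μ : ℝ, μ ≠ 1 ∧ Module.End.HasEigenvalue (Matrix.toLin' M) μ ∧ r = |μ|}.Finite := by
  have h : {μ : ℝ | Module.End.HasEigenvalue (Matrix.toLin' M) μ}.Finite := by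
    have := Module.End.finite_hasEigenvalue (Matrix.toLin' M)
    exact this
  refine (h.image (fun μ => |μ|)).subset ?_
  rintro r ⟨μ, -, h, rfl⟩
  exact ⟨μ, h, rfl⟩

lemma sum_poly (n : ℝ) (K : ℕ) : ∑ j ∈ Finset.range K, (j : ℝ) * (n - j) * (n - j - 1) * (n - j - 2)
   = n * (n-1) * (n-2) * ((K:ℝ) * (K - 1) / 2) - (3 * n^2 - 6 * n + 2) * ((K - 1) * K * (2 * K - 1) / 6)
    + (3 * n - 3) * ((K:ℝ) * (K - 1) / 2)^2 - (K - 1) * K * (2 * K - 1) * (3 * K^2 - 3 * K - 1) / 30 := by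
  induction K with
  | zero => simp
  | succ K ih => rw [Finset.sum_range_succ, ih]; push_cast; ring

lemma sum_poly' (n : ℕ) (hn : 1 ≤ n) : ∑ j ∈ Finset.range (n - 1), (j : ℝ) * (n - j) * (n - j - 1) * (n - j - 2)
   = ((n:ℝ) + 1) * n * (n - 1) * (n - 2) * (n - 3) / 20 := by
  rw [sum_poly]; push_cast [hn]; ring


section LC
variable {n : ℕ}

noncomputable def pos (x : LCOM n) (a : LLabel n) : Fin (n - 1) := (x.2.2.1 a).choose

lemma mem_iff (x : LCOM n) (a : LLabel n) (k : Fin (n - 1)) : a ∈ x.val k ↔ pos x a = k := by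
  have h := (x.2.2.1 a).choose_spec
  constructor
  · intro ha; exact (h.2 k ha).symm
  · rintro rfl; exact h.1

lemma val_eq (x : LCOM n) (k : Fin (n - 1)) : x.val k = univ.filter (fun a => pos x a = k) := by
  ext a; simp [mem_iff]

lemma pos_inj {x y : LCOM n} (h : pos x = pos y) : x = y := by
  apply Subtype.ext
  funext k
  rw [val_eq, val_eq, h]

lemma pos_card (x : LCOM n) (k : Fin (n - 1)) : (univ.filter (fun a => pos x a = k)).card = 2 := by
  rw [← val_eq]; exact x.2.1 k

lemma pos_lt (x : LCOM n) (j : Fin (n - 2)) : (j : ℕ) < (pos x (Sum.inr j) : ℕ) :=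
  x.2.2.2 j _ ((mem_iff _ _ _).2 rfl)

def mkL (q : LLabel n → Fin (n - 1)) (h2 : ∀ k, (univ.filter (fun a => q a = k)).card = 2)
    (h3 : ∀ j : Fin (n - 2), (j : ℕ) < (q (Sum.inr j) : ℕ)) : LCOM n :=
  ⟨fun k => univ.filter (fun a => q a = k), h2, fun a => ⟨q a, by simp, fun k' h => by
    simpa using (by simpa using h : q a = k').symm⟩, fun j k h => by
      have : q (Sum.inr j) = k := by simpa using h
      rw [← this]; exact h3 j⟩

lemma pos_mkL (q : LLabel n → Fin (n - 1)) (h2 h3) : pos (mkL q h2 h3) = q := by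
  funext a
  rw [← mem_iff]
  simp [mkL]

def Ok (x : LCOM n) (a b : LLabel n) : Prop :=
  ∀ j : Fin (n - 2), (j : ℕ) < (pos x (Equiv.swap a b (Sum.inr j)) : ℕ)

open Classical in
noncomputable def mv (x : LCOM n) (a b : LLabel n) : LCOM n :=
  if h : Ok x a b then mkL (fun c => pos x (Equiv.swap a b c)) (fun k => by
    exact (Finset.card_equiv (Equiv.swap a b) (fun c => by simp)).trans (pos_card x k)) h
  else x

lemma pos_mv {x : LCOM n} {a b : LLabel n} (h : Ok x a b) (c : LLabel n) :
    pos (mv x a b) c = pos x (Equiv.swap a b c) := by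
  unfold mv; rw [dif_pos h]; exact congrFun (pos_mkL _ _ _) c

lemma mv_not {x : LCOM n} {a b : LLabel n} (h : ¬ Ok x a b) : mv x a b = x := by
  unfold mv; rw [dif_neg h]

lemma Ok_mv {x : LCOM n} {a b : LLabel n} (h : Ok x a b) : Ok (mv x a b) a b := by
  intro j
  rw [pos_mv h, Equiv.swap_apply_self]
  exact pos_lt x j

lemma mv_mv (x : LCOM n) (a b : LLabel n) : mv (mv x a b) a b = x := by
  by_cases h : Ok x a b
  · apply pos_inj
    funext c
    rw [pos_mv (Ok_mv h), pos_mv h, Equiv.swap_apply_self]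
  · rw [mv_not h, mv_not h]

lemma Ok_comm {x : LCOM n} {a b : LLabel n} : Ok x a b ↔ Ok x b a := by
  unfold Ok; rw [Equiv.swap_comm]

lemma mv_comm (x : LCOM n) (a b : LLabel n) : mv x a b = mv x b a := by
  by_cases h : Ok x a b
  · apply pos_inj
    funext c
    rw [pos_mv h, pos_mv (Ok_comm.1 h), Equiv.swap_comm]
  · rw [mv_not h, mv_not (fun h' => h (Ok_comm.1 h'))]

noncomputable def mvE (a b : LLabel n) : LCOM n ≃ LCOM n where
  toFun x := mv x a b
  invFun x := mv x a b
  left_inv x := mv_mv x a b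
  right_inv x := mv_mv x a b

lemma idx_ne (k : Fin (n - 2)) : (idx1 k : Fin (n - 1)) ≠ idx2 k := by
  intro h
  have := congrArg Fin.val h
  simp [idx1, idx2] at this

lemma lswap_eq (x : LCOM n) (k : Fin (n - 2)) (l1 l2 : LLabel n) (h1 : pos x l1 = idx1 k)
    (h2 : pos x l2 = idx2 k) (i : Fin (n - 1)) (a : LLabel n) :
    a ∈ lswapFun n x.val k l1 l2 i ↔ pos x (Equiv.swap l1 l2 a) = i := by
  have hne := idx_ne k
  have hl : l1 ≠ l2 := by rintro rfl; exact hne (h1.symm.trans h2)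
  unfold lswapFun
  rw [Equiv.swap_apply_def]
  by_cases ha1 : a = l1
  · subst ha1
    rw [if_pos rfl, h2]
    by_cases hi : i = idx1 k
    · subst hi; simp [hl, hne.symm]
    · by_cases hi2 : i = idx2 k
      · subst hi2; simp [hne.symm]
      · simp only [if_neg hi, if_neg hi2, mem_iff, h1]
        exact ⟨fun h => absurd h.symm hi, fun h => absurd h.symm hi2⟩
  · rw [if_neg ha1]
    by_cases ha2 : a = l2
    · subst ha2
      rw [if_pos rfl, h1]
      by_cases hi : i = idx1 k
      · subst hi; simp
      · by_cases hi2 : i = idx2 k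
        · subst hi2; simp [hne, hne.symm, hl.symm]
        · simp only [if_neg hi, if_neg hi2, mem_iff, h2]
          exact ⟨fun h => absurd h.symm hi2, fun h => absurd h.symm hi⟩
    · rw [if_neg ha2]
      by_cases hi : i = idx1 k
      · subst hi; simp [ha1, ha2, mem_iff]
      · by_cases hi2 : i = idx2 k
        · subst hi2; simp [ha1, ha2, mem_iff, hne.symm]
        · simp [hi, hi2, mem_iff]

lemma isL_iff (x : LCOM n) (k : Fin (n - 2)) (l1 l2 : LLabel n) (h1 : pos x l1 = idx1 k)
    (h2 : pos x l2 = idx2 k) : IsLCOM n (lswapFun n x.val k l1 l2) ↔ Ok x l1 l2 := by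
  constructor
  · intro h j
    exact h.2.2 j _ ((lswap_eq x k l1 l2 h1 h2 _ _).2 rfl)
  · intro h
    have : lswapFun n x.val k l1 l2 = (mv x l1 l2).val := by
      funext i
      ext a
      rw [lswap_eq x k l1 l2 h1 h2, mem_iff, pos_mv h]
    rw [this]; exact (mv x l1 l2).2

lemma ldest_eq (x : LCOM n) (k : Fin (n - 2)) (l1 l2 : LLabel n) (h1 : pos x l1 = idx1 k)
    (h2 : pos x l2 = idx2 k) : lswapDest n x k l1 l2 = (mv x l1 l2).val := by
  unfold lswapDest
  by_cases h : Ok x l1 l2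
  · rw [if_pos ((isL_iff x k l1 l2 h1 h2).2 h)]
    funext i
    ext a
    rw [lswap_eq x k l1 l2 h1 h2, mem_iff, pos_mv h]
  · rw [if_neg (fun h' => h ((isL_iff x k l1 l2 h1 h2).1 h')), mv_not h]

lemma PL_eq (x y : LCOM n) : PL n x y = (1 / ((n : ℝ) - 2)) * ∑ k : Fin (n - 2),
    ∑ l1 ∈ x.val (idx1 k), ∑ l2 ∈ x.val (idx2 k),
    (1 / 4 : ℝ) * (if mv x l1 l2 = y then 1 else 0) := by
  unfold PL
  congr 1
  refine sum_congr rfl fun k _ => sum_congr rfl fun l1 h1 => sum_congr rfl fun l2 h2 => ?_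
  rw [ldest_eq x k l1 l2 ((mem_iff _ _ _).1 h1) ((mem_iff _ _ _).1 h2)]
  simp only [Subtype.ext_iff]

lemma PL_sum (x : LCOM n) (f : LCOM n → ℝ) : ∑ y, PL n x y * f y = (1 / ((n : ℝ) - 2)) *
    ∑ k : Fin (n - 2), ∑ l1 ∈ x.val (idx1 k), ∑ l2 ∈ x.val (idx2 k),
    (1 / 4 : ℝ) * f (mv x l1 l2) := by
  simp only [PL_eq, mul_assoc (1 / ((n : ℝ) - 2)), sum_mul]
  rw [← mul_sum]
  congr 1
  rw [sum_comm]
  refine sum_congr rfl fun k _ => ?_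
  rw [sum_comm]
  refine sum_congr rfl fun l1 _ => ?_
  rw [sum_comm]
  refine sum_congr rfl fun l2 _ => ?_
  simp

lemma PL_nonneg (hn : 4 ≤ n) (x y : LCOM n) : 0 ≤ PL n x y := by
  rw [PL_eq]
  have : (4:ℝ) ≤ n := by exact_mod_cast hn
  refine mul_nonneg (by apply div_nonneg <;> linarith) ?_
  refine sum_nonneg fun k _ => sum_nonneg fun l1 _ => sum_nonneg fun l2 _ => ?_
  split_ifs <;> norm_num

lemma PL_row (hn : 4 ≤ n) (x : LCOM n) : ∑ y, PL n x y = 1 := by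
  have h := PL_sum x (fun _ => 1)
  simp only [mul_one, sum_const, x.2.1, Finset.card_univ, Fintype.card_fin] at h
  rw [h]
  have : (4:ℝ) ≤ n := by exact_mod_cast hn
  have h2 : (n:ℝ) - 2 ≠ 0 := by intro h; linarith
  simp only [nsmul_eq_mul]
  rw [Nat.cast_sub (by omega)]
  push_cast
  field_simp
  norm_num

lemma PL_pos (hn : 4 ≤ n) (x : LCOM n) (k : Fin (n - 2)) (a b : LLabel n) (ha : pos x a = idx1 k)
    (hb : pos x b = idx2 k) : 0 < PL n x (mv x a b) := by
  rw [PL_eq]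
  have : (4:ℝ) ≤ n := by exact_mod_cast hn
  refine mul_pos (by apply div_pos <;> linarith) ?_
  have hnn : ∀ l1 l2 : LLabel n, (0:ℝ) ≤ (1 / 4 : ℝ) * (if mv x l1 l2 = mv x a b then 1 else 0) := by
    intro l1 l2; split_ifs <;> norm_num
  refine sum_pos' (fun k _ => sum_nonneg fun l1 _ => sum_nonneg fun l2 _ => hnn _ _) ⟨k, mem_univ _, ?_⟩
  refine sum_pos' (fun l1 _ => sum_nonneg fun l2 _ => hnn _ _) ⟨a, (mem_iff _ _ _).2 ha, ?_⟩
  refine sum_pos' (fun l2 _ => hnn _ _) ⟨b, (mem_iff _ _ _).2 hb, ?_⟩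
  simp

lemma PL_symm (x y : LCOM n) : PL n x y = PL n y x := by
  by_cases hxy : x = y
  · rw [hxy]
  have key : ∀ x y : LCOM n, PL n x y = (1 / ((n : ℝ) - 2)) * ∑ k : Fin (n - 2),
      ∑ l1 : LLabel n, ∑ l2 : LLabel n,
      (1 / 4 : ℝ) * (if pos x l1 = idx1 k ∧ pos x l2 = idx2 k ∧ mv x l1 l2 = y then 1 else 0) := by
    intro x y
    rw [PL_eq]
    congr 1
    refine sum_congr rfl fun k _ => ?_
    rw [val_eq, val_eq, sum_filter]
    refine sum_congr rfl fun l1 _ => ?_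
    rw [sum_filter]
    split_ifs with h
    · refine sum_congr rfl fun l2 _ => ?_
      by_cases h2 : pos x l2 = idx2 k <;> simp [h, h2]
    · simp [h]
  rw [key, key]
  congr 1
  refine sum_congr rfl fun k _ => ?_
  rw [sum_comm]
  refine sum_congr rfl fun l2 _ => sum_congr rfl fun l1 _ => ?_
  congr 1
  have imp : ∀ (x y : LCOM n) (l1 l2 : LLabel n), x ≠ y →
      (pos x l1 = idx1 k ∧ pos x l2 = idx2 k ∧ mv x l1 l2 = y) →
      (pos y l2 = idx1 k ∧ pos y l1 = idx2 k ∧ mv y l2 l1 = x) := by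
    rintro x y l1 l2 hne ⟨h1, h2, rfl⟩
    have hok : Ok x l1 l2 := by
      by_contra h
      exact hne (mv_not h).symm
    refine ⟨?_, ?_, ?_⟩
    · rw [pos_mv hok, Equiv.swap_apply_right, h1]
    · rw [pos_mv hok, Equiv.swap_apply_left, h2]
    · rw [mv_comm, mv_mv]
  exact if_congr ⟨imp x y l1 l2 hxy, imp y x l2 l1 (Ne.symm hxy)⟩ rfl rfl

lemma PL_diag (hn : 4 ≤ n) (x : LCOM n) : 0 < PL n x x := by
  let k : Fin (n - 2) := ⟨n - 3, by omega⟩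
  have hb : pos x (Sum.inr k) = idx2 k := by
    apply Fin.ext
    have := pos_lt x k
    have := (pos x (Sum.inr k)).isLt
    simp only [idx2, k] at *
    omega
  have hc := x.2.1 (idx1 k)
  obtain ⟨a, ha⟩ := Finset.card_pos.1 (by rw [hc]; norm_num : 0 < (x.val (idx1 k)).card)
  rw [mem_iff] at ha
  have h := PL_pos hn x k a (Sum.inr k) ha hb
  rwa [mv_not] at h
  intro hok
  have := hok k
  rw [Equiv.swap_apply_right, ha] at this
  simp [idx1] at this

end LC


section Mom
variable {n : ℕ}

def avl (k : ℕ) (x : LCOM n) (a : LLabel n) : Prop :=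
  k ≤ (pos x a : ℕ) ∧ ∀ j : Fin (n - 2), a = Sum.inr j → (j : ℕ) < k

open Classical in
noncomputable def av (k : ℕ) (x : LCOM n) (a : LLabel n) : ℝ := if avl k x a then 1 else 0

noncomputable def ps (k : ℕ) (x : LCOM n) (a : LLabel n) : ℝ := if (pos x a : ℕ) = k then 1 else 0

noncomputable def NN (k : ℕ) (x : LCOM n) : ℝ := ∑ i : Fin n, if k ≤ (pos x (Sum.inl i) : ℕ) then 1 else 0

noncomputable def LL (k : ℕ) (x : LCOM n) : ℝ := NN k x - NN (k + 1) x

lemma avl_ok {k : ℕ} {x : LCOM n} {a b : LLabel n} (ha : avl k x a) (hb : avl k x b) : Ok x a b := by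
  intro j
  rw [Equiv.swap_apply_def]
  split_ifs with h1 h2
  · exact lt_of_lt_of_le (ha.2 j h1.symm) hb.1
  · exact lt_of_lt_of_le (hb.2 j h2.symm) ha.1
  · exact pos_lt x j

lemma avl_mv {k : ℕ} {x : LCOM n} {a b : LLabel n} (ha : avl k x a) (hb : avl k x b) :
    avl k (mv x a b) a ∧ avl k (mv x a b) b := by
  have h := avl_ok ha hb
  refine ⟨⟨?_, ha.2⟩, ⟨?_, hb.2⟩⟩
  · rw [pos_mv h, Equiv.swap_apply_left]; exact hb.1
  · rw [pos_mv h, Equiv.swap_apply_right]; exact ha.1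

lemma exch (k : ℕ) (a b : LLabel n) (g : LCOM n → ℝ)
    (hg : ∀ x, avl k x a → avl k x b → g (mv x a b) = g x) :
    ∑ x, g x * (av k x a * av k x b * (ps k x a - ps k x b)) = 0 := by
  set T : LCOM n → ℝ := fun x => g x * (av k x a * av k x b * (ps k x a - ps k x b)) with hT
  have h1 : ∀ x, T (mv x a b) = - T x := by
    intro x
    by_cases h : avl k x a ∧ avl k x b
    · have h' := avl_mv h.1 h.2
      have hok := avl_ok h.1 h.2
      simp only [hT, hg x h.1 h.2, av, if_pos h.1, if_pos h.2, if_pos h'.1, if_pos h'.2, ps,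
        pos_mv hok, Equiv.swap_apply_left, Equiv.swap_apply_right]
      ring
    · have h' : ¬ (avl k (mv x a b) a ∧ avl k (mv x a b) b) := by
        intro h'
        apply h
        have := avl_mv h'.1 h'.2
        rwa [mv_mv] at this
      have e : ∀ y, ¬ (avl k y a ∧ avl k y b) → T y = 0 := by
        intro y hy
        simp only [hT, av]
        by_cases h1 : avl k y a
        · have h2 : ¬ avl k y b := fun h2 => hy ⟨h1, h2⟩
          simp [h2]
        · simp [h1]
      rw [e _ h, e _ h', neg_zero]
  have h2 : ∑ x, T (mv x a b) = ∑ x, T x := (mvE a b).sum_comp T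
  simp only [h1, sum_neg_distrib] at h2
  change ∑ x, T x = 0
  linarith

lemma sum_ge (k m : ℕ) : ∑ i ∈ range m, (if k ≤ i then (1:ℝ) else 0) = ((m - k : ℕ) : ℝ) := by
  induction m with
  | zero => simp
  | succ m ih =>
    rw [sum_range_succ, ih]
    split_ifs with h
    · rw [Nat.sub_add_comm h]; push_cast; ring
    · have h1 : m - k = 0 := by omega
      have h2 : m + 1 - k = 0 := by omega
      rw [h1, h2]; simp

lemma sum_ps' (x : LCOM n) (i : Fin (n - 1)) : ∑ a, (if pos x a = i then (1:ℝ) else 0) = 2 := by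
  rw [← sum_filter, sum_const, pos_card]; norm_num

lemma sum_ps (k : ℕ) (hk : k < n - 1) (x : LCOM n) : ∑ a, ps k x a = 2 := by
  rw [← sum_ps' x ⟨k, hk⟩]
  refine sum_congr rfl fun a _ => ?_
  simp [ps, Fin.ext_iff]

lemma av_ps (k : ℕ) (x : LCOM n) (a : LLabel n) : av k x a * ps k x a = ps k x a := by
  unfold ps av
  by_cases h : (pos x a : ℕ) = k
  · have : avl k x a := ⟨h.ge, by rintro j rfl; rw [← h]; exact pos_lt x j⟩
    simp [this]
  · simp [h]

lemma av_inl (k : ℕ) (x : LCOM n) (i : Fin n) :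
    av k x (Sum.inl i) = if k ≤ (pos x (Sum.inl i) : ℕ) then 1 else 0 := by
  simp [av, avl]

lemma sum_av_inl (k : ℕ) (x : LCOM n) : ∑ i, av k x (Sum.inl i) = NN k x := by
  simp only [av_inl, NN]

lemma sum_pos_ge (k : ℕ) (x : LCOM n) :
    ∑ a, (if k ≤ (pos x a : ℕ) then (1:ℝ) else 0) = 2 * ((n - 1 - k : ℕ) : ℝ) := by
  have h : ∀ a, (if k ≤ (pos x a : ℕ) then (1:ℝ) else 0) =
      ∑ i : Fin (n - 1), (if k ≤ (i : ℕ) then (1:ℝ) else 0) * (if pos x a = i then (1:ℝ) else 0) := by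
    intro a; simp
  simp only [h]
  rw [sum_comm]
  simp only [← mul_sum, sum_ps']
  rw [← sum_mul, Fin.sum_univ_eq_sum_range (fun i => if k ≤ i then (1:ℝ) else 0), sum_ge, mul_comm]

lemma sum_av (hn : 4 ≤ n) (k : ℕ) (hk : k < n - 1) (x : LCOM n) : ∑ a, av k x a = (n : ℝ) - k := by
  have h1 := sum_pos_ge k x
  rw [Fintype.sum_sum_type] at h1 ⊢
  have h2 : ∀ j : Fin (n - 2), (if k ≤ (pos x (Sum.inr j) : ℕ) then (1:ℝ) else 0)
      = av k x (Sum.inr j) + if k ≤ (j : ℕ) then 1 else 0 := by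
    intro j
    have := pos_lt x j
    have e : avl k x (Sum.inr j) ↔ k ≤ (pos x (Sum.inr j) : ℕ) ∧ (j : ℕ) < k := by
      simp [avl]
    simp only [av, e]
    by_cases h : k ≤ (j : ℕ)
    · simp [h, not_lt.2 h, (show k ≤ (pos x (Sum.inr j) : ℕ) by omega)]
    · simp [h, not_le.1 h]
  simp only [h2, sum_add_distrib, ← av_inl] at h1
  rw [Fin.sum_univ_eq_sum_range (fun i => if k ≤ i then (1:ℝ) else 0), sum_ge] at h1
  have e1 : ((n - 1 - k : ℕ) : ℝ) = n - 1 - k := by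
    rw [Nat.cast_sub (by omega), Nat.cast_sub (by omega)]; simp
  have e2 : ((n - 2 - k : ℕ) : ℝ) = n - 2 - k := by
    rw [Nat.cast_sub (by omega), Nat.cast_sub (by omega)]; simp
  rw [e1, e2] at h1
  linarith

lemma sum_ps_inl (k : ℕ) (x : LCOM n) : ∑ i, ps k x (Sum.inl i) = LL k x := by
  unfold LL NN ps
  rw [← sum_sub_distrib]
  refine sum_congr rfl fun i _ => ?_
  rcases lt_trichotomy (pos x (Sum.inl i) : ℕ) k with h | h | h
  · simp [h.ne, not_le.2 h, (show ¬ (k + 1 ≤ (pos x (Sum.inl i) : ℕ)) by omega)]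
  · simp [h]
  · simp [h.ne', h.le, (show (k + 1 ≤ (pos x (Sum.inl i) : ℕ)) by omega)]

def PInv (k : ℕ) (g : LCOM n → ℝ) : Prop :=
  ∀ x a b, avl k x a → avl k x b → g (mv x a b) = g x

lemma NN_inv (j k : ℕ) (hjk : j ≤ k) : PInv k (NN (n := n) j) := by
  intro x a b ha hb
  unfold NN
  refine sum_congr rfl fun i _ => ?_
  rw [pos_mv (avl_ok ha hb), Equiv.swap_apply_def]
  have h1 := ha.1
  have h2 := hb.1
  split_ifs <;> first | rfl | (exfalso; simp_all; omega) | (exfalso; subst_vars; omega)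

lemma lemA (hn : 4 ≤ n) (k : ℕ) (hk : k < n - 1) (g : LCOM n → ℝ) (hg : PInv k g) :
    ∑ x, g x * (((n : ℝ) - k) * LL k x - 2 * NN k x) = 0 := by
  have h : ∀ x, g x * (((n : ℝ) - k) * LL k x - 2 * NN k x) = ∑ i : Fin n, ∑ b : LLabel n,
      g x * (av k x (Sum.inl i) * av k x b * (ps k x (Sum.inl i) - ps k x b)) := by
    intro x
    simp only [← mul_sum]
    congr 1
    have e : ∀ (i : Fin n) (b : LLabel n), av k x (Sum.inl i) * av k x b * (ps k x (Sum.inl i) - ps k x b)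
        = (av k x (Sum.inl i) * ps k x (Sum.inl i)) * av k x b - av k x (Sum.inl i) * (av k x b * ps k x b) := by
      intro i b; ring
    simp only [e, av_ps, sum_sub_distrib, ← mul_sum, ← sum_mul, sum_ps k hk x, sum_av hn k hk x,
      sum_ps_inl, sum_av_inl]
    ring
  simp only [h]
  rw [sum_comm]
  refine sum_eq_zero fun i _ => ?_
  rw [sum_comm]
  refine sum_eq_zero fun b _ => ?_
  exact exch k _ _ g (fun x => hg x _ _)

lemma sum_ne {α : Type*} [Fintype α] [DecidableEq α] (c : α) (f : α → ℝ) :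
    ∑ b, (if b = c then 0 else f b) = (∑ b, f b) - f c := by
  have : ∀ b, (if b = c then 0 else f b) = f b - if b = c then f b else 0 := by
    intro b; split_ifs <;> simp
  simp [this, sum_sub_distrib]

lemma lemB (hn : 4 ≤ n) (k : ℕ) (hk : k < n - 1) (g : LCOM n → ℝ) (hg : PInv k g) :
    ∑ x, g x * (((n : ℝ) - k - 1) * (LL k x * (LL k x - 1)) - (NN k x - 1) * LL k x) = 0 := by
  have h : ∀ x, g x * (((n : ℝ) - k - 1) * (LL k x * (LL k x - 1)) - (NN k x - 1) * LL k x)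
      = ∑ i' : Fin n, ∑ i : Fin n, ∑ b : LLabel n,
      if i = i' then 0 else if b = Sum.inl i' then 0 else
      (g x * ps k x (Sum.inl i')) * (av k x (Sum.inl i) * av k x b * (ps k x (Sum.inl i) - ps k x b)) := by
    intro x
    have e : ∀ (i i': Fin n) (b : LLabel n), (if i = i' then 0 else if b = Sum.inl i' then 0 else
      (g x * ps k x (Sum.inl i')) * (av k x (Sum.inl i) * av k x b * (ps k x (Sum.inl i) - ps k x b)))
        = g x * (ps k x (Sum.inl i') * (
          (if i = i' then 0 else ps k x (Sum.inl i)) * (if b = Sum.inl i' then 0 else av k x b)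
          - (if i = i' then 0 else av k x (Sum.inl i)) * (if b = Sum.inl i' then 0 else ps k x b))) := by
      intro i i' b
      split_ifs
      · simp
      · simp
      · simp
      · rw [show av k x (Sum.inl i) * av k x b * (ps k x (Sum.inl i) - ps k x b)
        = (av k x (Sum.inl i) * ps k x (Sum.inl i)) * av k x b - av k x (Sum.inl i) * (av k x b * ps k x b) by ring]
        rw [av_ps, av_ps]; ring
    simp only [e, ← mul_sum]
    congr 1
    simp only [sum_sub_distrib, ← mul_sum, ← sum_mul, sum_ne, sum_ps k hk x, sum_av hn k hk x,
      sum_ps_inl, sum_av_inl]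
    have e2 : ∀ i' : Fin n, ps k x (Sum.inl i') * ((LL k x - ps k x (Sum.inl i')) * (↑n - ↑k - av k x (Sum.inl i')) -
        (NN k x - av k x (Sum.inl i')) * (2 - ps k x (Sum.inl i')))
        = ps k x (Sum.inl i') * ((LL k x - 1) * (↑n - ↑k - 1) - (NN k x - 1)) := by
      intro i'
      have h1 := av_ps k x (Sum.inl i')
      by_cases hp : (pos x (Sum.inl i') : ℕ) = k
      · have : ps k x (Sum.inl i') = 1 := by simp [ps, hp]
        rw [this] at h1 ⊢
        rw [mul_one] at h1
        rw [h1]; ring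
      · have : ps k x (Sum.inl i') = 0 := by simp [ps, hp]
        rw [this]; ring
    simp only [e2, ← sum_mul, sum_ps_inl]
    ring
  simp only [h]
  rw [sum_comm]
  refine sum_eq_zero fun i' _ => ?_
  rw [sum_comm]
  refine sum_eq_zero fun i _ => ?_
  rw [sum_comm]
  refine sum_eq_zero fun b _ => ?_
  by_cases h1 : i = i'
  · simp [h1]
  by_cases h2 : b = Sum.inl i'
  · simp [h2]
  simp only [if_neg h1, if_neg h2]
  refine exch k _ _ (fun x => g x * ps k x (Sum.inl i')) (fun x ha hb => ?_)
  rw [hg x _ _ ha hb]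
  congr 1
  simp only [ps]
  rw [pos_mv (avl_ok ha hb), Equiv.swap_apply_of_ne_of_ne]
  · intro h; exact h1 (Sum.inl_injective h).symm
  · exact fun h => h2 h.symm

end Mom


section Var
variable {n : ℕ}

lemma rels (hn : 4 ≤ n) (k : ℕ) (hk : k < n - 1) :
    ((n : ℝ) - k) * ∑ x : LCOM n, LL k x = 2 * ∑ x : LCOM n, NN k x ∧
    ((n : ℝ) - k) * ∑ x : LCOM n, NN k x * LL k x =
      2 * (∑ x : LCOM n, NN k x * (NN k x - 1) + ∑ x : LCOM n, NN k x) ∧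
    ((n : ℝ) - k - 1) * ∑ x : LCOM n, LL k x * (LL k x - 1) =
      ∑ x : LCOM n, NN k x * LL k x - ∑ x : LCOM n, LL k x := by
  have h1 := lemA hn k hk (fun _ => 1) (fun _ _ _ _ _ => rfl)
  have h2 := lemA hn k hk (NN k) (NN_inv k k le_rfl)
  have h3 := lemB hn k hk (fun _ => 1) (fun _ _ _ _ _ => rfl)
  refine ⟨?_, ?_, ?_⟩
  · rw [← sub_eq_zero, ← h1, mul_sum, mul_sum, ← sum_sub_distrib]
    exact sum_congr rfl fun x _ => by ring
  · rw [← sub_eq_zero, ← h2, ← sum_add_distrib, mul_sum, mul_sum, ← sum_sub_distrib]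
    exact sum_congr rfl fun x _ => by ring
  · rw [← sub_eq_zero, ← h3, ← sum_sub_distrib, mul_sum, ← sum_sub_distrib]
    exact sum_congr rfl fun x _ => by ring

lemma NN_zero (x : LCOM n) : NN 0 x = n := by simp [NN]

lemma NN_last (x : LCOM n) : NN (n - 1) x = 0 := by
  unfold NN
  refine sum_eq_zero fun i _ => ?_
  have := (pos x (Sum.inl i)).isLt
  rw [if_neg (by omega)]

lemma EN (hn : 4 ≤ n) (k : ℕ) (hk : k ≤ n - 1) :
    ((n : ℝ) - 1) * ∑ x : LCOM n, NN k x = Fintype.card (LCOM n) * (((n : ℝ) - k) * (n - k - 1)) := by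
  induction k with
  | zero => simp [NN_zero, Finset.card_univ]; ring
  | succ k ih =>
    have ih := ih (by omega)
    have h := (rels hn k (by omega)).1
    have hm : (0:ℝ) < n - k := by
      have : (k:ℝ) + 1 < n := by exact_mod_cast (by omega : k + 1 < n)
      linarith
    simp only [LL, sum_sub_distrib] at h
    push_cast
    apply mul_left_cancel₀ hm.ne'
    linear_combination ((n:ℝ) - k - 2) * ih - (n-1) * h

lemma EN2 (hn : 4 ≤ n) (k : ℕ) (hk : k ≤ n - 1) :
    ((n : ℝ) - 1) * (n - 2) * ∑ x : LCOM n, NN k x * (NN k x - 1) =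
      Fintype.card (LCOM n) * (((n : ℝ) - k) * (n - k - 1)^2 * (n - k - 2)) := by
  induction k with
  | zero => simp [NN_zero, Finset.card_univ]; ring
  | succ k ih =>
    have ih := ih (by omega)
    obtain ⟨h1, h2, h3⟩ := rels hn k (by omega)
    have hk1 : (k:ℝ) + 1 < n := by exact_mod_cast (by omega : k + 1 < n)
    have hm : (0:ℝ) < n - k := by linarith
    have hm1 : (0:ℝ) < n - k - 1 := by linarith
    have e : ∑ x : LCOM n, NN (k+1) x * (NN (k+1) x - 1) = ∑ x : LCOM n, NN k x * (NN k x - 1)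
        - 2 * ∑ x : LCOM n, NN k x * LL k x + ∑ x : LCOM n, LL k x * (LL k x - 1)
        + 2 * ∑ x : LCOM n, LL k x := by
      rw [mul_sum, mul_sum, ← sum_sub_distrib, ← sum_add_distrib, ← sum_add_distrib]
      refine sum_congr rfl fun x _ => ?_
      unfold LL; ring
    rw [e]
    generalize ∑ x : LCOM n, NN k x * (NN k x - 1) = e0 at *
    generalize ∑ x : LCOM n, NN k x * LL k x = s at *
    generalize ∑ x : LCOM n, LL k x * (LL k x - 1) = t at *
    generalize ∑ x : LCOM n, LL k x = l at *
    generalize ∑ x : LCOM n, NN k x = p at *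
    push_cast
    have el : l = 2 * p / (n - k) := by field_simp; linarith
    have es : s = 2 * (e0 + p) / (n - k) := by field_simp; linarith
    have et : t = (s - l) / (n - k - 1) := by field_simp; linarith
    have ee : e0 = Fintype.card (LCOM n) * (((n : ℝ) - k) * (n - k - 1)^2 * (n - k - 2)) / ((n - 1) * (n - 2)) := by
      have h1 : (n:ℝ) - 1 ≠ 0 := by have : (4:ℝ) ≤ n := by exact_mod_cast hn
                                    intro h; linarith
      have h2 : (n:ℝ) - 2 ≠ 0 := by have : (4:ℝ) ≤ n := by exact_mod_cast hn
                                    intro h; linarith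
      field_simp; linarith
    have h1 : (n:ℝ) - 1 ≠ 0 := by have : (4:ℝ) ≤ n := by exact_mod_cast hn
                                  intro h; linarith
    have h2 : (n:ℝ) - 2 ≠ 0 := by have : (4:ℝ) ≤ n := by exact_mod_cast hn
                                  intro h; linarith
    have hm' := hm.ne'
    have hm1' := hm1.ne'
    rw [et, es, el, ee]
    field_simp
    ring

noncomputable def DD (k : ℕ) (x : LCOM n) : ℝ := (2 * NN k x - ((n : ℝ) - k) * LL k x) / 3

lemma ED2 (hn : 4 ≤ n) (k : ℕ) (hk : k < n - 1) :
    ∑ x : LCOM n, DD k x ^ 2 = Fintype.card (LCOM n) * (2 / (9 * (n - 1) * (n - 2))) *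
      ((k : ℝ) * (n - k) * (n - k - 1) * (n - k - 2)) := by
  obtain ⟨h1, h2, h3⟩ := rels hn k (by omega)
  have i1 := EN hn k hk.le
  have i2 := EN2 hn k hk.le
  have hk1 : (k:ℝ) + 1 < n := by exact_mod_cast (by omega : k + 1 < n)
  have hm : (n:ℝ) - k ≠ 0 := by intro h; linarith
  have hm1 : (n:ℝ) - k - 1 ≠ 0 := by intro h; linarith
  have hn4 : (4:ℝ) ≤ n := by exact_mod_cast hn
  have hn1 : (n:ℝ) - 1 ≠ 0 := by intro h; linarith
  have hn2 : (n:ℝ) - 2 ≠ 0 := by intro h; linarith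
  have e : ∑ x : LCOM n, DD k x ^ 2 = (4 / 9) * (∑ x : LCOM n, NN k x * (NN k x - 1) + ∑ x : LCOM n, NN k x)
      - (4 * (n - k) / 9) * ∑ x : LCOM n, NN k x * LL k x
      + ((n - k)^2 / 9) * (∑ x : LCOM n, LL k x * (LL k x - 1) + ∑ x : LCOM n, LL k x) := by
    rw [← sum_add_distrib, ← sum_add_distrib, mul_sum, mul_sum, mul_sum, ← sum_sub_distrib, ← sum_add_distrib]
    refine sum_congr rfl fun x _ => ?_
    unfold DD; ring
  rw [e]
  generalize ∑ x : LCOM n, NN k x * (NN k x - 1) = e0 at *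
  generalize ∑ x : LCOM n, NN k x * LL k x = s at *
  generalize ∑ x : LCOM n, LL k x * (LL k x - 1) = t at *
  generalize ∑ x : LCOM n, LL k x = l at *
  generalize ∑ x : LCOM n, NN k x = p at *
  have el : l = 2 * p / (n - k) := by field_simp; linarith
  have es : s = 2 * (e0 + p) / (n - k) := by field_simp; linarith
  have et : t = (s - l) / (n - k - 1) := by field_simp; linarith
  have ep : p = Fintype.card (LCOM n) * (((n : ℝ) - k) * (n - k - 1)) / (n - 1) := by
    field_simp; linarith
  have ee : e0 = Fintype.card (LCOM n) * (((n : ℝ) - k) * (n - k - 1)^2 * (n - k - 2)) / ((n - 1) * (n - 2)) := by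
    field_simp; linarith
  rw [et, es, el, ee, ep]
  field_simp
  ring

noncomputable def HH (k : ℕ) (x : LCOM n) : ℝ := ∑ j ∈ range k, DD j x

lemma DD_inv (j k : ℕ) (hjk : j < k) : PInv k (DD (n := n) j) := by
  intro x a b ha hb
  unfold DD LL
  rw [NN_inv j k hjk.le x a b ha hb, NN_inv (j+1) k hjk x a b ha hb]

lemma HH_inv (k : ℕ) : PInv k (HH (n := n) k) := by
  intro x a b ha hb
  unfold HH
  exact sum_congr rfl fun j hj => DD_inv j k (mem_range.1 hj) x a b ha hb

lemma EgD (hn : 4 ≤ n) (k : ℕ) (hk : k < n - 1) (g : LCOM n → ℝ) (hg : PInv k g) :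
    ∑ x, g x * DD k x = 0 := by
  have h := lemA hn k hk g hg
  have : ∑ x, g x * DD k x = (-1/3) * ∑ x, g x * (((n : ℝ) - k) * LL k x - 2 * NN k x) := by
    rw [mul_sum]
    refine sum_congr rfl fun x _ => ?_
    unfold DD; ring
  rw [this, h, mul_zero]

lemma EH (hn : 4 ≤ n) : ∑ x : LCOM n, HH (n - 1) x = 0 := by
  unfold HH
  rw [sum_comm]
  refine sum_eq_zero fun k hk => ?_
  have := EgD hn k (mem_range.1 hk) (fun _ => 1) (fun _ _ _ _ _ => rfl)
  simpa using this

lemma EH2 (hn : 4 ≤ n) (k : ℕ) (hk : k ≤ n - 1) :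
    ∑ x : LCOM n, HH k x ^ 2 = ∑ j ∈ range k, ∑ x : LCOM n, DD j x ^ 2 := by
  induction k with
  | zero => simp [HH]
  | succ k ih =>
    rw [sum_range_succ, ← ih (by omega)]
    have h := EgD hn k (by omega) _ (HH_inv k)
    have e : ∑ x : LCOM n, HH (k+1) x ^ 2 = ∑ x : LCOM n, HH k x ^ 2 + 2 * ∑ x : LCOM n, HH k x * DD k x
        + ∑ x : LCOM n, DD k x ^ 2 := by
      rw [mul_sum, ← sum_add_distrib, ← sum_add_distrib]
      refine sum_congr rfl fun x _ => ?_
      simp only [HH, sum_range_succ]; ring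
    rw [e, h]; ring

lemma varH (hn : 4 ≤ n) : ∑ x : LCOM n, HH (n - 1) x ^ 2 =
    Fintype.card (LCOM n) * ((n : ℝ) * (n + 1) * (n - 3) / 90) := by
  rw [EH2 hn _ le_rfl, sum_congr rfl fun j hj => ED2 hn j (mem_range.1 hj), ← mul_sum,
    sum_poly' n (by omega)]
  have hn4 : (4:ℝ) ≤ n := by exact_mod_cast hn
  have hn1 : (n:ℝ) - 1 ≠ 0 := by intro h; linarith
  have hn2 : (n:ℝ) - 2 ≠ 0 := by intro h; linarith
  field_simp
  ring

noncomputable def SS (x : LCOM n) : ℝ := ∑ i : Fin n, ((pos x (Sum.inl i) : ℕ) : ℝ)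

lemma sum_NN (hn : 4 ≤ n) (x : LCOM n) : ∑ k ∈ range (n - 1), NN k x = SS x + n := by
  unfold NN SS
  rw [sum_comm]
  have : (n : ℝ) = ∑ i : Fin n, (1:ℝ) := by simp
  conv_rhs => rw [this]
  rw [← sum_add_distrib]
  refine sum_congr rfl fun i _ => ?_
  have hl := (pos x (Sum.inl i)).isLt
  rw [← sum_filter, sum_const]
  have : (range (n - 1)).filter (fun k => k ≤ (pos x (Sum.inl i) : ℕ)) = range ((pos x (Sum.inl i) : ℕ) + 1) := by
    ext k; simp; omega
  rw [this, card_range]; simp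

lemma HH_eq (hn : 4 ≤ n) (x : LCOM n) : HH (n - 1) x = SS x + (n - n * (n + 1) / 3) := by
  have h : ∀ k, HH k x = ∑ i ∈ range k, NN i x + NN k x * (n - k + 1) / 3 - n * (n + 1) / 3 := by
    intro k
    induction k with
    | zero => simp [HH, NN_zero]
    | succ k ih =>
      have : HH (k+1) x = HH k x + DD k x := by simp [HH, sum_range_succ]
      rw [this, ih, sum_range_succ, DD, LL]; push_cast; ring
  rw [h, sum_NN hn, NN_last]; ring

end Var


section Proj
variable {n : ℕ}

def lab (hn : 4 ≤ n) : LLabel n → Fin (n - 1) :=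
  Sum.elim (fun _ => ⟨0, by omega⟩) (fun j => ⟨(j : ℕ) + 1, by have := j.isLt; omega⟩)

def zz (hn : 4 ≤ n) : Fin (n - 1) := ⟨0, by omega⟩

lemma lab_inl (hn : 4 ≤ n) (i : Fin n) : lab hn (Sum.inl i) = zz hn := rfl

lemma lab_inr_val (hn : 4 ≤ n) (j : Fin (n - 2)) : (lab hn (Sum.inr j) : ℕ) = j + 1 := rfl

lemma lab_inr_ne (hn : 4 ≤ n) (j : Fin (n - 2)) : lab hn (Sum.inr j) ≠ zz hn := by
  intro h
  have := congrArg Fin.val h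
  simp [lab_inr_val, zz] at this

lemma lab_inr_inj (hn : 4 ≤ n) (j j' : Fin (n - 2)) :
    lab hn (Sum.inr j) = lab hn (Sum.inr j') ↔ j = j' := by
  rw [Fin.ext_iff, Fin.ext_iff, lab_inr_val, lab_inr_val]; omega

lemma lab_cases (hn : 4 ≤ n) (s : Fin (n - 1)) : s = zz hn ∨ ∃ j, s = lab hn (Sum.inr j) := by
  by_cases h : (s : ℕ) = 0
  · left; exact Fin.ext h
  · right
    refine ⟨⟨(s : ℕ) - 1, by have := s.isLt; omega⟩, Fin.ext ?_⟩
    rw [lab_inr_val]; simp only; omega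

lemma cnt (hn : 4 ≤ n) (q : LLabel n → Fin (n - 1)) (k s : Fin (n - 1)) :
    Multiset.count s ((univ.filter (fun a => q a = k)).val.map (lab hn)) =
    ∑ a, if q a = k ∧ s = lab hn a then 1 else 0 := by
  rw [Multiset.count_map, ← Finset.filter_val, ← Finset.card_def, Finset.filter_filter,
    Finset.card_filter]

lemma cnt0 (hn : 4 ≤ n) (q : LLabel n → Fin (n - 1)) (k : Fin (n - 1)) :
    Multiset.count (zz hn) ((univ.filter (fun a => q a = k)).val.map (lab hn)) =
    ∑ i, if q (Sum.inl i) = k then 1 else 0 := by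
  rw [cnt, Fintype.sum_sum_type]
  simp [lab_inl, (lab_inr_ne hn _).symm]

lemma cntj (hn : 4 ≤ n) (q : LLabel n → Fin (n - 1)) (k : Fin (n - 1)) (j : Fin (n - 2)) :
    Multiset.count (lab hn (Sum.inr j)) ((univ.filter (fun a => q a = k)).val.map (lab hn)) =
    if q (Sum.inr j) = k then 1 else 0 := by
  rw [cnt, Fintype.sum_sum_type]
  simp only [lab_inl, lab_inr_ne, and_false, if_false, sum_const_zero, zero_add, lab_inr_inj]
  rw [Finset.sum_eq_single j]
  · simp
  · intro b _ hb; rw [if_neg]; exact fun h => hb h.2.symm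
  · simp

def praw (hn : 4 ≤ n) (p : Fin (n - 1) → Finset (LLabel n)) : Fin (n - 1) → Multiset (Fin (n - 1)) :=
  fun k => (p k).val.map (lab hn)

lemma isU_praw (hn : 4 ≤ n) (x : LCOM n) : IsUCOMraw n (praw hn x.val) := by
  refine ⟨fun k => ?_, fun s => ?_, fun j k hj hm => ?_⟩
  · simp only [praw, Multiset.card_map]; exact x.2.1 k
  · simp only [praw, val_eq]
    rcases lab_cases hn s with rfl | ⟨j, rfl⟩
    · simp only [cnt0]
      rw [sum_comm]
      simp [zz]
    · simp only [cntj]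
      simp [lab_inr_val]
  · simp only [praw, Multiset.mem_map] at hm
    obtain ⟨a, ha, rfl⟩ := hm
    rcases a with i | j
    · exact absurd rfl hj
    · have := x.2.2.2 j k ha
      rw [lab_inr_val]; omega

def proj (hn : 4 ≤ n) (x : LCOM n) : UCOM n :=
  ⟨fun k => ⟨praw hn x.val k, (isU_praw hn x).1 k⟩, isU_praw hn x⟩

lemma uraw_proj (hn : 4 ≤ n) (x : LCOM n) : uraw n (proj hn x) = praw hn x.val := rfl

lemma uraw_inj {u v : UCOM n} (h : uraw n u = uraw n v) : u = v := by
  apply Subtype.ext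
  funext k
  exact Subtype.ext (congrFun h k)

lemma praw_lswap (hn : 4 ≤ n) (x : LCOM n) (k : Fin (n - 2)) (l1 l2 : LLabel n)
    (h1 : pos x l1 = idx1 k) (h2 : pos x l2 = idx2 k) :
    uswapFun n (praw hn x.val) k (lab hn l1) (lab hn l2) = praw hn (lswapFun n x.val k l1 l2) := by
  have hne := idx_ne k
  have m1 := (mem_iff x l1 _).2 h1
  have m2 := (mem_iff x l2 _).2 h2
  have n1 : l1 ∉ (x.val (idx2 k)).erase l2 := by
    intro h; have := (mem_iff _ _ _).1 (mem_of_mem_erase h); exact hne (h1.symm.trans this)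
  have n2 : l2 ∉ (x.val (idx1 k)).erase l1 := by
    intro h; have := (mem_iff _ _ _).1 (mem_of_mem_erase h); exact hne (this.symm.trans h2)
  funext i
  unfold uswapFun praw lswapFun
  split_ifs
  · rw [insert_val_of_notMem n2, Multiset.map_cons, erase_val, Multiset.map_erase_of_mem _ _ m1]
  · rw [insert_val_of_notMem n1, Multiset.map_cons, erase_val, Multiset.map_erase_of_mem _ _ m2]
  · rfl

lemma isU_iff (hn : 4 ≤ n) (x : LCOM n) (k : Fin (n - 2)) (l1 l2 : LLabel n)
    (h1 : pos x l1 = idx1 k) (h2 : pos x l2 = idx2 k) :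
    IsUCOMraw n (praw hn (lswapFun n x.val k l1 l2)) ↔ Ok x l1 l2 := by
  constructor
  · intro h j
    have hm := (lswap_eq x k l1 l2 h1 h2 _ (Sum.inr j)).2 rfl
    have := h.2.2 (lab hn (Sum.inr j)) _ (by rw [lab_inr_val]; omega) (Multiset.mem_map_of_mem _ hm)
    rw [lab_inr_val] at this
    omega
  · intro h
    exact isU_praw hn ⟨_, (isL_iff x k l1 l2 h1 h2).2 h⟩

lemma udest_eq (hn : 4 ≤ n) (x : LCOM n) (k : Fin (n - 2)) (l1 l2 : LLabel n)
    (h1 : pos x l1 = idx1 k) (h2 : pos x l2 = idx2 k) :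
    uswapDest n (proj hn x) k (lab hn l1) (lab hn l2) = uraw n (proj hn (mv x l1 l2)) := by
  have hd := ldest_eq x k l1 l2 h1 h2
  unfold uswapDest
  unfold lswapDest at hd
  rw [uraw_proj, uraw_proj, praw_lswap hn x k l1 l2 h1 h2]
  by_cases h : Ok x l1 l2
  · rw [if_pos ((isL_iff x k l1 l2 h1 h2).2 h)] at hd
    rw [if_pos ((isU_iff hn x k l1 l2 h1 h2).2 h), hd]
  · rw [if_neg (fun h' => h ((isU_iff hn x k l1 l2 h1 h2).1 h')), mv_not h]

lemma PU_proj (hn : 4 ≤ n) (x : LCOM n) (v : UCOM n) :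
    PU n (proj hn x) v = ∑ y, PL n x y * (if proj hn y = v then 1 else 0) := by
  rw [PL_sum, PU]
  congr 1
  refine sum_congr rfl fun k _ => ?_
  rw [uraw_proj]
  simp only [praw, Multiset.map_map]
  change ∑ l1 ∈ x.val (idx1 k), _ = _
  refine sum_congr rfl fun l1 m1 => ?_
  change ∑ l2 ∈ x.val (idx2 k), _ = _
  refine sum_congr rfl fun l2 m2 => ?_
  simp only [Function.comp_apply]
  rw [udest_eq hn x k l1 l2 ((mem_iff _ _ _).1 m1) ((mem_iff _ _ _).1 m2)]
  congr 1
  exact if_congr ⟨fun h => uraw_inj h, fun h => by rw [h]⟩ rfl rfl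

lemma lump (hn : 4 ≤ n) (x : LCOM n) (f : UCOM n → ℝ) :
    (PUmat n).mulVec f (proj hn x) = ∑ y, PL n x y * f (proj hn y) := by
  simp only [Matrix.mulVec, dotProduct, PUmat, Matrix.of_apply, PU_proj, sum_mul]
  rw [sum_comm]
  refine sum_congr rfl fun y _ => ?_
  simp [mul_assoc]

lemma proj_surj (hn : 4 ≤ n) : Function.Surjective (proj (n := n) hn) := by
  intro u
  obtain ⟨hu1, hu2, hu3⟩ := u.2
  set r := uraw n u with hr
  change ∀ k, Multiset.card (r k) = 2 at hu1
  change ∀ s, ∑ k, (r k).count s = _ at hu2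
  change ∀ (j k : Fin (n - 1)), (j : ℕ) ≠ 0 → j ∈ r k → (j : ℕ) ≤ (k : ℕ) at hu3
  have hc : Fintype.card (Fin n) = Fintype.card (Σ k : Fin (n - 1), Fin ((r k).count (zz hn))) := by
    rw [Fintype.card_sigma]
    simp only [Fintype.card_fin]
    rw [hu2]; simp [zz]
  let e := Fintype.equivOfCardEq hc
  have hex : ∀ j : Fin (n - 2), ∃ k, lab hn (Sum.inr j) ∈ r k := by
    intro j
    by_contra hcon
    push Not at hcon
    have := hu2 (lab hn (Sum.inr j))
    rw [sum_eq_zero (fun k _ => Multiset.count_eq_zero.2 (hcon k)), lab_inr_val] at this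
    simp at this
  choose t ht using hex
  obtain ⟨q, hq1, hq2⟩ : ∃ q : LLabel n → Fin (n - 1), (∀ i, q (Sum.inl i) = (e i).1) ∧
      (∀ j, q (Sum.inr j) = t j) := ⟨Sum.elim (fun i => (e i).1) t, fun _ => rfl, fun _ => rfl⟩
  have hq : ∀ k, (univ.filter (fun a => q a = k)).val.map (lab hn) = r k := by
    intro k
    ext s
    rcases lab_cases hn s with rfl | ⟨j, rfl⟩
    · rw [cnt0]
      simp only [hq1]
      rw [e.sum_comp (fun p => if p.1 = k then 1 else 0), Fintype.sum_sigma]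
      rw [Finset.sum_eq_single k (fun b _ hb => by simp [hb]) (by simp)]
      simp
    · rw [cntj]
      simp only [hq2]
      have h1 := hu2 (lab hn (Sum.inr j))
      rw [lab_inr_val, if_neg (by omega), ← Finset.add_sum_erase _ _ (mem_univ (t j))] at h1
      have h2 := Multiset.one_le_count_iff_mem.2 (ht j)
      split_ifs with h
      · subst h; omega
      · have h3 : ∑ k ∈ univ.erase (t j), (r k).count (lab hn (Sum.inr j)) = 0 := by omega
        exact ((Finset.sum_eq_zero_iff.1 h3) k (mem_erase.2 ⟨fun h' => h h'.symm, mem_univ _⟩)).symm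
  refine ⟨mkL q (fun k => ?_) (fun j => ?_), uraw_inj ?_⟩
  · exact (Multiset.card_map (lab hn) _).symm.trans ((congrArg Multiset.card (hq k)).trans (hu1 k))
  · have := hu3 (lab hn (Sum.inr j)) (t j) (by rw [lab_inr_val]; omega) (ht j)
    rw [lab_inr_val] at this
    rw [hq2]
    exact this
  · funext k
    exact hq k

lemma nonemp (hn : 4 ≤ n) : Nonempty (LCOM n) := by
  let q : LLabel n → Fin (n - 1) :=
    Sum.elim (fun i => ⟨(i : ℕ) - 1, by have := i.isLt; omega⟩) (fun j => ⟨(j : ℕ) + 1, by have := j.isLt; omega⟩)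
  refine ⟨mkL q (fun k => ?_) (fun j => by simp [q])⟩
  rw [Finset.card_eq_two]
  by_cases hk : (k : ℕ) = 0
  · refine ⟨Sum.inl ⟨0, by omega⟩, Sum.inl ⟨1, by omega⟩, by simp, ?_⟩
    ext a
    rcases a with i | j
    · simp [q, Fin.ext_iff]; omega
    · simp [q, Fin.ext_iff]; omega
  · have := k.isLt
    refine ⟨Sum.inl ⟨k + 1, by omega⟩, Sum.inr ⟨k - 1, by omega⟩, by simp, ?_⟩
    ext a
    rcases a with i | j
    · simp [q, Fin.ext_iff]; omega
    · simp [q, Fin.ext_iff]; omega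

def tight (x : LCOM n) : Prop := ∀ j : Fin (n - 2), (pos x (Sum.inr j) : ℕ) = j + 1

lemma tight_proj (hn : 4 ≤ n) (x y : LCOM n) (hx : tight x) (hy : tight y) : proj hn x = proj hn y := by
  apply uraw_inj
  funext k
  rw [uraw_proj, uraw_proj]
  have hj : ∀ s, s ≠ zz hn → (praw hn x.val k).count s = (praw hn y.val k).count s := by
    intro s hs
    rcases lab_cases hn s with rfl | ⟨j, rfl⟩
    · exact absurd rfl hs
    · simp only [praw, val_eq, cntj]
      have : pos x (Sum.inr j) = pos y (Sum.inr j) := Fin.ext (by rw [hx j, hy j])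
      rw [this]
  have hs : ∀ x : LCOM n, ∑ s, (praw hn x.val k).count s = 2 := by
    intro x
    rw [Multiset.sum_count_eq_card (fun a _ => mem_univ a)]
    exact (isU_praw hn x).1 k
  ext s
  by_cases h : s = zz hn
  · subst h
    have h1 := hs x
    have h2 := hs y
    rw [← Finset.add_sum_erase _ _ (mem_univ (zz hn))] at h1 h2
    rw [sum_congr rfl (fun s hs => hj s (ne_of_mem_erase hs))] at h1
    omega
  · exact hj s h

lemma reach (hn : 4 ≤ n) (G : LCOM n → ℝ)
    (hG : ∀ x k a b, pos x a = idx1 k → pos x b = idx2 k → G (mv x a b) = G x) :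
    ∀ (m : ℕ) (x : LCOM n), ∑ j : Fin (n - 2), (pos x (Sum.inr j) : ℕ) = m → ∃ y, tight y ∧ G x = G y := by
  intro m
  induction m using Nat.strong_induction_on with
  | _ m ih =>
  intro x hm
  by_cases ht : tight x
  · exact ⟨x, ht, rfl⟩
  set B := univ.filter (fun j : Fin (n - 2) => (pos x (Sum.inr j) : ℕ) ≠ j + 1) with hB
  have hne : B.Nonempty := by
    unfold tight at ht
    push Not at ht
    obtain ⟨j, hj⟩ := ht
    exact ⟨j, by simp [hB, hj]⟩
  obtain ⟨j, hjB, hmin⟩ := Finset.exists_min_image B (fun j => (pos x (Sum.inr j) : ℕ)) hne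
  have hj1 : (pos x (Sum.inr j) : ℕ) ≠ j + 1 := by simpa [hB] using hjB
  have hj2 := pos_lt x j
  have hj3 := (pos x (Sum.inr j)).isLt
  let k : Fin (n - 2) := ⟨(pos x (Sum.inr j) : ℕ) - 1, by omega⟩
  have hb : pos x (Sum.inr j) = idx2 k := Fin.ext (by simp only [idx2, k]; omega)
  have hk : ((idx1 k : Fin (n - 1)) : ℕ) + 1 = pos x (Sum.inr j) := by simp only [idx1, k]; omega
  have htk : ∀ j', pos x (Sum.inr j') = idx1 k → (j' : ℕ) + 1 = idx1 k := by
    intro j' h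
    by_contra hc
    have : j' ∈ B := by simp only [hB, mem_filter, mem_univ, true_and]; rw [h]; exact fun h => hc h.symm
    have := hmin j' this
    rw [h] at this
    omega
  obtain ⟨i, hi⟩ : ∃ i : Fin n, pos x (Sum.inl i) = idx1 k := by
    obtain ⟨a, b, hab, hs⟩ := Finset.card_eq_two.1 (x.2.1 (idx1 k))
    have ha' : pos x a = idx1 k := (mem_iff _ _ _).1 (by rw [hs]; simp)
    have hb' : pos x b = idx1 k := (mem_iff _ _ _).1 (by rw [hs]; simp)
    rcases a with i | j1
    · exact ⟨i, ha'⟩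
    rcases b with i | j2
    · exact ⟨i, hb'⟩
    exfalso
    apply hab
    have h1 := htk _ ha'
    have h2 := htk _ hb'
    congr 1
    apply Fin.ext; omega
  have hsw : ∀ j', j' ≠ j → Equiv.swap (Sum.inl i : LLabel n) (Sum.inr j) (Sum.inr j') = Sum.inr j' := by
    intro j' h
    exact Equiv.swap_apply_of_ne_of_ne (by simp) (by simpa using h)
  have hok : Ok x (Sum.inl i) (Sum.inr j) := by
    intro j'
    by_cases h : j' = j
    · subst h; rw [Equiv.swap_apply_right, hi]; omega
    · rw [hsw j' h]; exact pos_lt x j'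
  have hlt : ∑ j' : Fin (n - 2), (pos (mv x (Sum.inl i) (Sum.inr j)) (Sum.inr j') : ℕ) < m := by
    rw [← hm]
    refine sum_lt_sum (fun j' _ => ?_) ⟨j, mem_univ _, ?_⟩
    · by_cases h : j' = j
      · subst h; rw [pos_mv hok, Equiv.swap_apply_right, hi]; omega
      · rw [pos_mv hok, hsw j' h]
    · rw [pos_mv hok, Equiv.swap_apply_right, hi]; omega
  obtain ⟨y, hy, hxy⟩ := ih _ hlt _ rfl
  exact ⟨y, hy, by rw [← hxy, hG x k _ _ hi hb]⟩

lemma gen_dir {S : Type*} [Fintype S] (P : S → S → ℝ) (hs : ∀ x y, P x y = P y x)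
    (h1 : ∀ x, ∑ y, P x y = 1) (h : S → ℝ) :
    ∑ x, h x ^ 2 - ∑ x, h x * ∑ y, P x y * h y = (1 / 2) * ∑ x, ∑ y, P x y * (h x - h y) ^ 2 := by
  have e : ∑ x, ∑ y, P x y * (h x - h y) ^ 2 = ∑ x, ∑ y, P x y * h x ^ 2 + ∑ x, ∑ y, P x y * h y ^ 2
      - 2 * ∑ x, ∑ y, h x * (P x y * h y) := by
    simp only [mul_sum, ← sum_add_distrib, ← sum_sub_distrib]
    exact sum_congr rfl fun x _ => sum_congr rfl fun y _ => by ring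
  have e1 : ∑ x, ∑ y, P x y * h x ^ 2 = ∑ x, h x ^ 2 := by simp only [← sum_mul, h1, one_mul]
  have e2 : ∑ x, ∑ y, P x y * h y ^ 2 = ∑ x, h x ^ 2 := by
    rw [sum_comm, ← e1]
    exact sum_congr rfl fun x _ => sum_congr rfl fun y _ => by rw [hs]
  rw [e, e1, e2]
  simp only [← mul_sum]
  ring

lemma harm_const (hn : 4 ≤ n) (g : UCOM n → ℝ) (hg : (PUmat n).mulVec g = g) (x y : LCOM n) :
    g (proj hn x) = g (proj hn y) := by
  have hL : ∀ x, ∑ y, PL n x y * g (proj hn y) = g (proj hn x) := by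
    intro x; rw [← lump hn, hg]
  have hd := gen_dir (PL n) PL_symm (PL_row hn) (fun x => g (proj hn x))
  simp only [hL] at hd
  have hz : ∑ x, ∑ y, PL n x y * (g (proj hn x) - g (proj hn y)) ^ 2 = 0 := by
    have : ∑ x : LCOM n, g (proj hn x) ^ 2 - ∑ x, g (proj hn x) * g (proj hn x) = 0 := by
      rw [sub_eq_zero]; exact sum_congr rfl fun x _ => by ring
    linarith
  have hnn : ∀ x y : LCOM n, 0 ≤ PL n x y * (g (proj hn x) - g (proj hn y)) ^ 2 :=
    fun x y => mul_nonneg (PL_nonneg hn x y) (sq_nonneg _)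
  have hall : ∀ x y : LCOM n, PL n x y * (g (proj hn x) - g (proj hn y)) ^ 2 = 0 := by
    intro x y
    have h1 := (sum_eq_zero_iff_of_nonneg (fun x _ => sum_nonneg fun y _ => hnn x y)).1 hz x (mem_univ _)
    exact (sum_eq_zero_iff_of_nonneg (fun y _ => hnn x y)).1 h1 y (mem_univ _)
  have hG : ∀ (x : LCOM n) k a b, pos x a = idx1 k → pos x b = idx2 k →
      g (proj hn (mv x a b)) = g (proj hn x) := by
    intro x k a b ha hb
    have h1 := PL_pos hn x k a b ha hb
    rcases mul_eq_zero.1 (hall x (mv x a b)) with h | h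
    · linarith
    · have := pow_eq_zero_iff (two_ne_zero) |>.1 h
      linarith
  obtain ⟨x', hx', ex⟩ := reach hn (fun x => g (proj hn x)) hG _ x rfl
  obtain ⟨y', hy', ey⟩ := reach hn (fun x => g (proj hn x)) hG _ y rfl
  rw [ex, ey, tight_proj hn x' y' hx' hy']

lemma SS_step (x : LCOM n) (k : Fin (n - 2)) (a b : LLabel n) (ha : pos x a = idx1 k)
    (hb : pos x b = idx2 k) : (SS x - SS (mv x a b)) ^ 2 ≤ 1 := by
  by_cases hok : Ok x a b
  swap
  · rw [mv_not hok]; simp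
  let wt : LLabel n → ℝ := Sum.elim (fun _ => 1) (fun _ => 0)
  have hS : ∀ x : LCOM n, SS x = ∑ c, wt c * ((pos x c : ℕ) : ℝ) := by
    intro x; rw [Fintype.sum_sum_type]; simp [SS, wt]
  have hab : a ≠ b := by rintro rfl; exact idx_ne k (ha.symm.trans hb)
  have e : SS x - SS (mv x a b) = wt b - wt a := by
    rw [hS, hS, ← sum_sub_distrib, Fintype.sum_eq_add a b hab]
    · rw [pos_mv hok, pos_mv hok, Equiv.swap_apply_left, Equiv.swap_apply_right, ha, hb]
      simp only [idx1, idx2]; push_cast; ring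
    · rintro c ⟨h1, h2⟩
      rw [pos_mv hok, Equiv.swap_apply_of_ne_of_ne h1 h2, sub_self]
  rw [e]
  rcases a with _ | _ <;> rcases b with _ | _ <;> simp [wt]

lemma dir_le (hn : 4 ≤ n) (x : LCOM n) : ∑ y, PL n x y * (SS x - SS y) ^ 2 ≤ 1 := by
  rw [← PL_row hn x]
  have h1 := PL_sum x (fun _ => 1)
  simp only [mul_one] at h1
  rw [h1, PL_sum x (fun y => (SS x - SS y) ^ 2)]
  have : (4:ℝ) ≤ n := by exact_mod_cast hn
  refine mul_le_mul_of_nonneg_left ?_ (by apply div_nonneg <;> linarith)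
  refine sum_le_sum fun k _ => sum_le_sum fun l1 m1 => sum_le_sum fun l2 m2 => ?_
  have := SS_step x k l1 l2 ((mem_iff _ _ _).1 m1) ((mem_iff _ _ _).1 m2)
  linarith

noncomputable def HU (hn : 4 ≤ n) (u : UCOM n) : ℝ :=
  ∑ k : Fin (n - 1), ((k : ℕ) : ℝ) * ((uraw n u k).count (zz hn) : ℝ) + (n - n * (n + 1) / 3)

lemma HU_proj (hn : 4 ≤ n) (x : LCOM n) : HU hn (proj hn x) = HH (n - 1) x := by
  rw [HH_eq hn, HU, SS, uraw_proj]
  congr 1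
  simp only [praw, val_eq, cnt0]
  push_cast
  simp only [mul_sum]
  rw [sum_comm]
  refine sum_congr rfl fun i _ => ?_
  simp

open Classical in
noncomputable def ww (hn : 4 ≤ n) (u : UCOM n) : ℝ := ∑ x : LCOM n, if proj hn x = u then 1 else 0

lemma ww_pos (hn : 4 ≤ n) (u : UCOM n) : 0 < ww hn u := by
  obtain ⟨x, hx⟩ := proj_surj hn u
  unfold ww
  refine sum_pos' (fun y _ => by split_ifs <;> norm_num) ⟨x, mem_univ _, by simp [hx]⟩

lemma ww_sum (hn : 4 ≤ n) (F : UCOM n → ℝ) : ∑ u, ww hn u * F u = ∑ x, F (proj hn x) := by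
  classical
  simp only [ww, sum_mul]
  rw [sum_comm]
  refine sum_congr rfl fun x _ => ?_
  simp

lemma ww_rev (hn : 4 ≤ n) (u v : UCOM n) : ww hn u * PUmat n u v = ww hn v * PUmat n v u := by
  classical
  have key : ∀ u v, ww hn u * PUmat n u v = ∑ x, ∑ y, (if proj hn x = u then 1 else 0) * ((if proj hn y = v then 1 else 0) * PL n x y) := by
    intro u v
    simp only [ww, sum_mul]
    refine sum_congr rfl fun x _ => ?_
    rw [← mul_sum]
    by_cases h : proj hn x = u
    · subst h
      simp only [if_true, one_mul, PUmat, Matrix.of_apply, PU_proj]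
      exact sum_congr rfl fun y _ => by rw [mul_comm]
    · simp [h]
  rw [key, key, sum_comm]
  refine sum_congr rfl fun y _ => sum_congr rfl fun x _ => ?_
  rw [PL_symm]; ring

lemma gap_bound (hn : 4 ≤ n) :
    specGap (PUmat n) ≤ 45 / ((n : ℝ) * ((n : ℝ) + 1) * ((n : ℝ) - 3)) := by
  have hn4 : (4:ℝ) ≤ n := by exact_mod_cast hn
  have hs := gen_spec (PUmat n) (ww hn) (ww_pos hn) (ww_rev hn) (HU hn) (lamStar (PUmat n))
    (fun μ h1 h2 => (le_abs_self μ).trans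
      (le_csSup (gen_lamStar_set_finite _).bddAbove ⟨μ, h1, h2, rfl⟩))
    (by
      intro g hg
      simp only [mul_assoc]
      rw [ww_sum hn (fun u => g u * HU hn u)]
      obtain ⟨x0⟩ := nonemp hn
      rw [sum_congr rfl (fun x _ => by rw [harm_const hn g hg x x0, HU_proj]), ← mul_sum, EH hn, mul_zero])
  simp only [mul_assoc] at hs
  rw [ww_sum hn (fun u => HU hn u * (PUmat n).mulVec (HU hn) u), ww_sum hn (fun u => HU hn u ^ 2)] at hs
  simp only [lump, HU_proj] at hs
  have hd := gen_dir (PL n) PL_symm (PL_row hn) (fun x => HH (n - 1) x)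
  have hle : ∑ x : LCOM n, ∑ y : LCOM n, PL n x y * (HH (n - 1) x - HH (n - 1) y) ^ 2 ≤ Fintype.card (LCOM n) := by
    have : ((Fintype.card (LCOM n) : ℕ) : ℝ) = ∑ x : LCOM n, (1:ℝ) := by simp
    rw [this]
    refine sum_le_sum fun x _ => ?_
    refine le_trans (le_of_eq ?_) (dir_le hn x)
    refine sum_congr rfl fun y _ => ?_
    rw [HH_eq hn, HH_eq hn]; ring
  have hV := varH hn
  have hC : (0:ℝ) < Fintype.card (LCOM n) := by
    have := nonemp hn
    exact_mod_cast Fintype.card_pos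
  rw [hV] at hs hd
  unfold specGap
  have hp : 0 < (n : ℝ) * ((n : ℝ) + 1) * ((n : ℝ) - 3) := by
    apply mul_pos (by positivity); linarith
  rw [le_div_iff₀ hp]
  set V := (n : ℝ) * ((n : ℝ) + 1) * ((n : ℝ) - 3)
  set C := ((Fintype.card (LCOM n) : ℕ) : ℝ)
  have : C * ((1 - lamStar (PUmat n)) * V) ≤ C * 45 := by nlinarith
  exact le_of_mul_le_mul_left this hC

lemma lam_le (hn : 4 ≤ n) : lamStar (PUmat n) ≤ lamStar (PLmat n) := by
  have hsub : {r : ℝ | ∃ μ : ℝ, μ ≠ 1 ∧ Module.End.HasEigenvalue (Matrix.toLin' (PUmat n)) μ ∧ r = |μ|}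
      ⊆ {r : ℝ | ∃ μ : ℝ, μ ≠ 1 ∧ Module.End.HasEigenvalue (Matrix.toLin' (PLmat n)) μ ∧ r = |μ|} := by
    rintro r ⟨μ, h1, h2, rfl⟩
    refine ⟨μ, h1, ?_, rfl⟩
    obtain ⟨g, hg, h⟩ := gen_hasEig.1 h2
    refine gen_hasEig.2 ⟨fun x => g (proj hn x), ?_, ?_⟩
    · intro h0
      apply hg
      ext u
      obtain ⟨x, rfl⟩ := proj_surj hn u
      exact congrFun h0 x
    · ext x
      have := lump hn x g
      rw [h] at this
      simp only [Matrix.mulVec, dotProduct, PLmat, Matrix.of_apply, ← this, Pi.smul_apply]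
  unfold lamStar
  rcases Set.eq_empty_or_nonempty {r : ℝ | ∃ μ : ℝ, μ ≠ 1 ∧ Module.End.HasEigenvalue (Matrix.toLin' (PUmat n)) μ ∧ r = |μ|} with h | h
  · rw [h, Real.sSup_empty]
    apply Real.sSup_nonneg
    rintro r ⟨μ, -, -, rfl⟩
    exact abs_nonneg _
  · exact csSup_le_csSup (gen_lamStar_set_finite _).bddAbove h hsub

lemma lam_lt (hn : 4 ≤ n) : lamStar (PLmat n) < 1 := by
  unfold lamStar
  rcases Set.eq_empty_or_nonempty {r : ℝ | ∃ μ : ℝ, μ ≠ 1 ∧ Module.End.HasEigenvalue (Matrix.toLin' (PLmat n)) μ ∧ r = |μ|} with h | h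
  · rw [h, Real.sSup_empty]; norm_num
  · rw [Set.Finite.csSup_lt_iff (gen_lamStar_set_finite _) h]
    rintro r ⟨μ, h1, h2, rfl⟩
    exact gen_abs_lt (PLmat n) (PL_nonneg hn) (PL_row hn) (PL_diag hn) μ h2 h1

end Proj

theorem stmt15 (n : ℕ) (hn : 4 ≤ n) :
    1 / specGap (PLmat n) ≥ 1 / specGap (PUmat n) ∧
    1 / specGap (PUmat n) ≥ (2 / 90 : ℝ) * ((n : ℝ) * ((n : ℝ) + 1) * ((n : ℝ) - 3)) ∧
    specGap (PLmat n) ≤ specGap (PUmat n) ∧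
    specGap (PUmat n) ≤ 45 / ((n : ℝ) * ((n : ℝ) + 1) * ((n : ℝ) - 3)) := by
  have h1 : specGap (PLmat n) ≤ specGap (PUmat n) := by
    unfold specGap; linarith [lam_le hn]
  have h2 : 0 < specGap (PLmat n) := by
    unfold specGap; linarith [lam_lt hn]
  have h3 := gap_bound hn
  have hn4 : (4:ℝ) ≤ n := by exact_mod_cast hn
  have hp : 0 < (n : ℝ) * ((n : ℝ) + 1) * ((n : ℝ) - 3) := by
    apply mul_pos (by positivity); linarith
  refine ⟨one_div_le_one_div_of_le h2 h1, ?_, h1, h3⟩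
  have h4 := h2.trans_le h1
  rw [ge_iff_le, le_div_iff₀ h4]
  rw [le_div_iff₀ hp] at h3
  linarith
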